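/- Let R be an integral domain. Then R is a PvMD if and only if Tor₂^R(M, N), the value at (M, N) of the second left derived functor of the tensor product, is GV-torsion for every pair of R-modules M and N. -/

import Mathlib

open TensorProduct CategoryTheory

/-- A finitely generated ideal `J` is a GV-ideal if the natural map
`R → Hom_R(J, R)`, sending `r` to multiplication by `r`, is bijective. -/
def IsGVIdeal {R : Type*} [CommRing R] (J : Ideal R) : Prop :=
  J.FG ∧ Function.Bijective fun r : R => (r • J.subtype : J →ₗ[R] R)

/-- An element `m` of an `R`-module is a GV-torsion element if it is
annihilated by some GV-ideal. -/
def IsGVTorsionElem (R : Type*) [CommRing R] {M : Type*} [AddCommGroup M] [Module R M]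
    (m : M) : Prop :=
  ∃ J : Ideal R, IsGVIdeal J ∧ ∀ j ∈ J, j • m = 0

/-- `R` is a PvMD if for every nonzero finitely generated ideal `I` of `R` there is a
GV-ideal `J` with `J ⊆ I·I⁻¹` (inside the quotient field `K`). -/
def IsPvMD (R : Type*) [CommRing R] [IsDomain R] (K : Type*) [Field K] [Algebra R K]
    [IsFractionRing R K] : Prop :=
  ∀ I : Ideal R, I ≠ ⊥ → I.FG →
    ∃ J : Ideal R, IsGVIdeal J ∧
      (J : FractionalIdeal (nonZeroDivisors R) K) ≤
        (I : FractionalIdeal (nonZeroDivisors R) K) *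
          (I : FractionalIdeal (nonZeroDivisors R) K)⁻¹

section GVIdeal

variable {R : Type*} [CommRing R] [IsDomain R]

theorem isGVIdeal_iff {J : Ideal R} :
    IsGVIdeal J ↔ J.FG ∧ J ≠ ⊥ ∧ ∀ p q : R, q ≠ 0 → (∀ j ∈ J, q ∣ p * j) → q ∣ p := by
  refine and_congr_right fun _ ↦ ⟨fun h ↦ ?_, fun ⟨hJ, h⟩ ↦ ⟨?_, fun f ↦ ?_⟩⟩
  · have hJ : J ≠ ⊥ := by
      rintro rfl
      refine one_ne_zero (α := R) (h.1 (LinearMap.ext fun x ↦ ?_))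
      have hx : x = 0 := Subsingleton.elim _ _
      simp [hx]
    refine ⟨hJ, fun p q hq hpq ↦ ?_⟩
    choose f hf using fun j : J ↦ hpq j j.2
    let F : J →ₗ[R] R :=
      { toFun := f
        map_add' := fun x y ↦ mul_left_cancel₀ hq <| by
          rw [mul_add, ← hf, ← hf, ← hf, Submodule.coe_add, mul_add]
        map_smul' := fun r x ↦ mul_left_cancel₀ hq <| by
          rw [← hf, RingHom.id_apply, Submodule.coe_smul, smul_eq_mul, smul_eq_mul,
            mul_left_comm, hf, mul_left_comm] }
    obtain ⟨r, hr⟩ := h.2 F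
    obtain ⟨j, hj, hj0⟩ := J.ne_bot_iff.mp hJ
    refine ⟨r, mul_right_cancel₀ hj0 ?_⟩
    have hrj : r * j = f ⟨j, hj⟩ := LinearMap.congr_fun hr ⟨j, hj⟩
    rw [mul_assoc, hrj, ← hf ⟨j, hj⟩]
  · obtain ⟨j, hj, hj0⟩ := J.ne_bot_iff.mp hJ
    intro a b hab
    exact mul_right_cancel₀ hj0 (LinearMap.congr_fun hab ⟨j, hj⟩)
  · obtain ⟨c, hc, hc0⟩ := J.ne_bot_iff.mp hJ
    have key : ∀ j : J, f ⟨c, hc⟩ * j = c * f j := fun j ↦ by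
      have h1 : (j : R) • (⟨c, hc⟩ : J) = c • j := Subtype.ext (mul_comm _ _)
      have h2 := congrArg f h1
      rw [map_smul, map_smul, smul_eq_mul, smul_eq_mul] at h2
      rw [mul_comm, h2]
    obtain ⟨r, hr⟩ := h (f ⟨c, hc⟩) c hc0 fun j hj ↦ ⟨f ⟨j, hj⟩, key ⟨j, hj⟩⟩
    refine ⟨r, LinearMap.ext fun j ↦ ?_⟩
    have hj : c * (r * j) = c * f j := by rw [← key, hr, mul_assoc]
    exact mul_left_cancel₀ hc0 hj

theorem isGVIdeal_top : IsGVIdeal (⊤ : Ideal R) :=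
  isGVIdeal_iff.mpr ⟨⟨{1}, by simp⟩, top_ne_bot, fun p q _ h ↦ by simpa using h 1 trivial⟩

theorem IsGVIdeal.mul {I J : Ideal R} (hI : IsGVIdeal I) (hJ : IsGVIdeal J) :
    IsGVIdeal (I * J) := by
  rw [isGVIdeal_iff] at *
  refine ⟨hI.1.mul hJ.1, mul_ne_zero hI.2.1 hJ.2.1, fun p q hq h ↦ hI.2.2 p q hq fun i hi ↦
    hJ.2.2 _ q hq fun j hj ↦ ?_⟩
  rw [mul_assoc]
  exact h _ (Ideal.mul_mem_mul hi hj)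

theorem IsGVIdeal.exists_isGVIdeal_le {J A : Ideal R} (hJ : IsGVIdeal J)
    (h : ∀ j ∈ J, ∃ J', IsGVIdeal J' ∧ ∀ i ∈ J', i * j ∈ A) :
    ∃ J', IsGVIdeal J' ∧ J' ≤ A := by
  classical
  have key : ∀ s : Finset R, (s : Set R) ⊆ J →
      ∃ J', IsGVIdeal J' ∧ ∀ i ∈ J', ∀ j ∈ s, i * j ∈ A := by
    intro s
    induction s using Finset.induction_on with
    | empty => exact fun _ ↦ ⟨⊤, isGVIdeal_top, by simp⟩
    | insert a s _ ih =>
      intro hs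
      rw [Finset.coe_insert, Set.insert_subset_iff] at hs
      obtain ⟨J₁, h₁, h₁'⟩ := h a hs.1
      obtain ⟨J₂, h₂, h₂'⟩ := ih hs.2
      refine ⟨J₁ * J₂, h₁.mul h₂, fun i hi j hj ↦ ?_⟩
      rcases Finset.mem_insert.mp hj with rfl | hj
      · exact h₁' i (Ideal.mul_le_left hi)
      · exact h₂' i (Ideal.mul_le_right hi) j hj
  obtain ⟨s, rfl⟩ := hJ.1
  obtain ⟨J', h₁, h₂⟩ := key s Submodule.subset_span
  refine ⟨J' * Ideal.span s, h₁.mul hJ, ?_⟩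
  rw [Ideal.mul_le]
  intro i hi j hj
  exact Submodule.span_le (p := Submodule.comap (LinearMap.mulLeft R i) A) |>.mpr (h₂ i hi) hj

end GVIdeal

section Tor

universe u

variable {R : Type u} [CommRing R]

theorem IsGVTorsionElem.map {M N : Type*} [AddCommGroup M] [Module R M] [AddCommGroup N]
    [Module R N] (f : M →ₗ[R] N) {m : M} (hm : IsGVTorsionElem R m) :
    IsGVTorsionElem R (f m) := by
  obtain ⟨J, hJ, h⟩ := hm
  exact ⟨J, hJ, fun j hj ↦ by rw [← map_smul, h j hj, map_zero]⟩

theorem ModuleCat.forall_isGVTorsionElem_homology_iff (S : ShortComplex (ModuleCat.{u} R)) :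
    (∀ x : S.homology, IsGVTorsionElem R x) ↔
      ∀ c : S.X₂, S.g.hom c = 0 →
        ∃ J : Ideal R, IsGVIdeal J ∧ ∀ r ∈ J, r • c ∈ LinearMap.range S.f.hom := by
  let e : S.homology ≃ₗ[R] (LinearMap.ker S.g.hom ⧸ LinearMap.range S.moduleCatToCycles) :=
    S.moduleCatHomologyIso.toLinearEquiv
  have hmem : ∀ c : LinearMap.ker S.g.hom,
      c ∈ LinearMap.range S.moduleCatToCycles ↔ (c : S.X₂) ∈ LinearMap.range S.f.hom :=
    fun c ↦ ⟨fun ⟨x, hx⟩ ↦ ⟨x, congrArg Subtype.val hx⟩, fun ⟨x, hx⟩ ↦ ⟨x, Subtype.ext hx⟩⟩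
  constructor
  · intro h c hc
    obtain ⟨J, hJ, hJ'⟩ := (h (e.symm (Submodule.Quotient.mk ⟨c, hc⟩))).map e.toLinearMap
    refine ⟨J, hJ, fun r hr ↦ ?_⟩
    have := hJ' r hr
    rw [LinearEquiv.coe_coe, e.apply_symm_apply, ← Submodule.Quotient.mk_smul,
      Submodule.Quotient.mk_eq_zero, hmem] at this
    exact this
  · intro h x
    obtain ⟨⟨c, hc⟩, hx⟩ := Submodule.Quotient.mk_surjective _ (e x)
    obtain ⟨J, hJ, hJ'⟩ := h c hc
    suffices IsGVTorsionElem R (e x) by simpa using this.map e.symm.toLinearMap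
    refine ⟨J, hJ, fun r hr ↦ ?_⟩
    rw [← hx, ← Submodule.Quotient.mk_smul, Submodule.Quotient.mk_eq_zero, hmem]
    exact hJ' r hr

theorem forall_isGVTorsionElem_tor_succ_iff {M N : ModuleCat.{u} R} (P : ProjectiveResolution N)
    (n : ℕ) :
    (∀ x : ((Tor (ModuleCat.{u} R) (n + 1)).obj M).obj N, IsGVTorsionElem R x) ↔
      ∀ c : M ⊗[R] P.complex.X (n + 1), (P.complex.d (n + 1) n).hom.lTensor M c = 0 →
        ∃ J : Ideal R, IsGVIdeal J ∧
          ∀ r ∈ J, r • c ∈ LinearMap.range ((P.complex.d (n + 2) (n + 1)).hom.lTensor M) := by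
  let F := (MonoidalCategory.tensoringLeft (ModuleCat.{u} R)).obj M
  let K := (F.mapHomologicalComplex _).obj P.complex
  let e : ((Tor (ModuleCat.{u} R) (n + 1)).obj M).obj N ≅
      (K.sc' (n + 2) (n + 1) n).homology :=
    P.isoLeftDerivedObj F (n + 1) ≪≫
      K.homologyIsoSc' (n + 2) (n + 1) n (by simp) (by simp)
  refine Iff.trans ⟨fun h x ↦ ?_, fun h x ↦ ?_⟩
    (ModuleCat.forall_isGVTorsionElem_homology_iff (K.sc' (n + 2) (n + 1) n))
  · simpa using (h (e.inv.hom x)).map e.hom.hom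
  · simpa using (h (e.hom.hom x)).map e.inv.hom

theorem CategoryTheory.ProjectiveResolution.function_exact {N : ModuleCat.{u} R}
    (P : ProjectiveResolution N) (n : ℕ) :
    Function.Exact (P.complex.d (n + 2) (n + 1)).hom (P.complex.d (n + 1) n).hom :=
  (ShortComplex.ShortExact.moduleCat_exact_iff_function_exact _).mp (P.exact_succ n)

end Tor

section FiniteRank

variable {R : Type*} [CommRing R]

theorem comp_mem_range_dualTensorHom {N N' : Type*} [AddCommGroup N] [Module R N]
    [AddCommGroup N'] [Module R N'] (f : N →ₗ[R] N') (g : N' →ₗ[R] N) {u : N' →ₗ[R] N'}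
    (hu : u ∈ LinearMap.range (dualTensorHom R N' N')) :
    g ∘ₗ u ∘ₗ f ∈ LinearMap.range (dualTensorHom R N N) := by
  obtain ⟨t, rfl⟩ := hu
  induction t with
  | zero => simp
  | add x y hx hy =>
    rw [map_add, LinearMap.add_comp, LinearMap.comp_add]
    exact add_mem hx hy
  | tmul φ y => exact ⟨(φ ∘ₗ f) ⊗ₜ g y, LinearMap.ext fun z ↦ by simp⟩

theorem exists_comp_eq_of_mem_range_dualTensorHom {N P Q : Type*} [AddCommGroup N] [Module R N]
    [AddCommGroup P] [Module R P] [AddCommGroup Q] [Module R Q] (d : P →ₗ[R] Q) (i : N →ₗ[R] Q)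
    (hi : LinearMap.range i ≤ LinearMap.range d) {u : N →ₗ[R] N}
    (hu : u ∈ LinearMap.range (dualTensorHom R N N)) : ∃ h : N →ₗ[R] P, d ∘ₗ h = i ∘ₗ u := by
  obtain ⟨t, rfl⟩ := hu
  induction t with
  | zero => exact ⟨0, by simp⟩
  | add x y hx hy =>
    obtain ⟨h, hh⟩ := hx
    obtain ⟨h', hh'⟩ := hy
    exact ⟨h + h', by rw [LinearMap.comp_add, hh, hh', map_add, LinearMap.comp_add]⟩
  | tmul φ y =>
    obtain ⟨p, hp⟩ := hi ⟨y, rfl⟩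
    exact ⟨φ.smulRight p, LinearMap.ext fun z ↦ by simp [hp]⟩

variable (R) in
/-- The ideal of all `r` such that multiplication by `r` on `N` is a finite sum of maps that
factor through `R`. -/
noncomputable def finiteRankIdeal (N : Type*) [AddCommGroup N] [Module R N] : Ideal R :=
  (LinearMap.range (dualTensorHom R N N)).comap
    (LinearMap.toSpanSingleton R (N →ₗ[R] N) LinearMap.id)

theorem mem_finiteRankIdeal {N : Type*} [AddCommGroup N] [Module R N] {r : R} :
    r ∈ finiteRankIdeal R N ↔
      r • (LinearMap.id : N →ₗ[R] N) ∈ LinearMap.range (dualTensorHom R N N) :=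
  Iff.rfl

/-- If `r` lies in `I * I⁻¹`, where `I` is the image of `φ`, then `r • φ` factors through an
endomorphism of finite rank. -/
theorem exists_finiteRank_of_mem_mul_inv [IsDomain R] {K : Type*} [Field K] [Algebra R K]
    [IsFractionRing R K] {N : Type*} [AddCommGroup N]
    [Module R N] (φ : N →ₗ[R] R) (hφ : LinearMap.range φ ≠ ⊥) {r : R}
    (hr : algebraMap R K r ∈
      ((LinearMap.range φ : Ideal R) : FractionalIdeal (nonZeroDivisors R) K) *
        ((LinearMap.range φ : Ideal R) : FractionalIdeal (nonZeroDivisors R) K)⁻¹) :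
    ∃ θ ∈ LinearMap.range (dualTensorHom R N N), φ ∘ₗ θ = r • φ := by
  have hinj := IsFractionRing.injective R K
  suffices ∃ θ ∈ LinearMap.range (dualTensorHom R N N), ∀ z,
      algebraMap R K (φ (θ z)) =
        algebraMap R K r * algebraMap R K (φ z) by
    obtain ⟨θ, hθ, h⟩ := this
    exact ⟨θ, hθ, LinearMap.ext fun z ↦ hinj (by simp [h])⟩
  refine FractionalIdeal.mul_induction_on hr (fun i hi y hy ↦ ?_) fun x y hx hy ↦ ?_
  · obtain ⟨-, ⟨w, rfl⟩, rfl⟩ := (FractionalIdeal.mem_coeIdeal _).mp hi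
    rw [FractionalIdeal.mem_inv_iff (FractionalIdeal.coeIdeal_ne_zero.mpr hφ)] at hy
    have hy' : ∀ z, ∃ s, algebraMap R K s =
        y * algebraMap R K (φ z) := fun z ↦
      (FractionalIdeal.mem_one_iff _).mp (hy _ (FractionalIdeal.mem_coeIdeal_of_mem _ ⟨z, rfl⟩))
    choose f hf using hy'
    let F : N →ₗ[R] R :=
      { toFun := f
        map_add' := fun a b ↦ hinj (by simp [hf, mul_add])
        map_smul' := fun a b ↦ hinj (by simp [hf, mul_left_comm]) }
    refine ⟨dualTensorHom R N N (F ⊗ₜ w), ⟨_, rfl⟩, fun z ↦ ?_⟩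
    simp only [dualTensorHom_apply, map_smul, smul_eq_mul, map_mul]
    rw [show F z = f z from rfl, hf]
    ring
  · obtain ⟨θ, hθ, h⟩ := hx
    obtain ⟨θ', hθ', h'⟩ := hy
    exact ⟨θ + θ', add_mem hθ hθ', fun z ↦ by simp [h, h', add_mul]⟩

theorem IsPvMD.exists_isGVIdeal_forall_finiteRank [IsDomain R] {K : Type*} [Field K] [Algebra R K]
    [IsFractionRing R K] (hR : IsPvMD R K) {N : Type*} [AddCommGroup N] [Module R N]
    [Module.Finite R N] (φ : N →ₗ[R] R) :
    ∃ J : Ideal R, IsGVIdeal J ∧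
      ∀ j ∈ J, ∃ θ ∈ LinearMap.range (dualTensorHom R N N), φ ∘ₗ θ = j • φ := by
  by_cases hφ : LinearMap.range φ = ⊥
  · refine ⟨⊤, isGVIdeal_top, fun j _ ↦ ⟨0, zero_mem _, ?_⟩⟩
    rw [LinearMap.range_eq_bot.mp hφ, LinearMap.comp_zero, smul_zero]
  · obtain ⟨J, hJ, hJ'⟩ := hR (LinearMap.range φ) hφ (Module.Finite.iff_fg.mp inferInstance)
    exact ⟨J, hJ, fun j hj ↦ exists_finiteRank_of_mem_mul_inv φ hφ
      (hJ' (FractionalIdeal.mem_coeIdeal_of_mem _ hj))⟩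

theorem IsPvMD.exists_isGVIdeal_le_finiteRankIdeal_of_forall_eq_zero [IsDomain R]
    {K : Type*} [Field K] [Algebra R K] [IsFractionRing R K] (hR : IsPvMD R K)
    {ι : Type*} (s : Finset ι) {N : Type*} [AddCommGroup N] [Module R N] [Module.Finite R N]
    (φ : ι → N →ₗ[R] R) (hφ : ∀ z, (∀ i ∈ s, φ i z = 0) → z = 0) :
    ∃ J, IsGVIdeal J ∧ J ≤ finiteRankIdeal R N := by
  classical
  induction s using Finset.induction_on generalizing N with
  | empty =>
    refine ⟨⊤, isGVIdeal_top, fun r _ ↦ ?_⟩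
    have hid : r • (LinearMap.id : N →ₗ[R] N) = 0 :=
      LinearMap.ext fun z ↦ by rw [hφ z (by simp), map_zero, map_zero]
    rw [mem_finiteRankIdeal, hid]
    exact zero_mem _
  | insert a s _ ih =>
    obtain ⟨J, hJ, hJ'⟩ := hR.exists_isGVIdeal_forall_finiteRank (φ a)
    refine hJ.exists_isGVIdeal_le fun j hj ↦ ?_
    obtain ⟨θ, hθ, hφθ⟩ := hJ' j hj
    let ψ : N →ₗ[R] N := j • LinearMap.id - θ
    have hψ (z) : φ a (ψ z) = 0 := by
      have : φ a (θ z) = j • φ a z := LinearMap.congr_fun hφθ z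
      simp [ψ, this]
    obtain ⟨J', hJ₁, hJ₂⟩ := ih (N := LinearMap.range ψ)
      (fun i ↦ φ i ∘ₗ (LinearMap.range ψ).subtype) <| by
        rintro ⟨_, z, rfl⟩ hz
        refine Subtype.ext (hφ _ fun i hi ↦ ?_)
        rcases Finset.mem_insert.mp hi with rfl | hi
        · exact hψ z
        · exact hz i hi
    refine ⟨J', hJ₁, fun j' hj' ↦ ?_⟩
    have h := comp_mem_range_dualTensorHom ψ.rangeRestrict (LinearMap.range ψ).subtype
      (mem_finiteRankIdeal.mp (hJ₂ hj'))
    rw [mem_finiteRankIdeal]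
    convert add_mem h (Submodule.smul_mem _ j' hθ) using 1
    ext z
    simp [ψ, mul_smul, smul_sub]

theorem IsPvMD.exists_isGVIdeal_le_finiteRankIdeal [IsDomain R]
    {K : Type*} [Field K] [Algebra R K] [IsFractionRing R K] (hR : IsPvMD R K)
    {P : Type*} [AddCommGroup P] [Module R P] [Module.Projective R P] (N : Submodule R P)
    (hN : N.FG) : ∃ J, IsGVIdeal J ∧ J ≤ finiteRankIdeal R N := by
  classical
  obtain ⟨σ, hσ⟩ := Module.projective_def'.mp (inferInstance : Module.Projective R P)
  obtain ⟨t, ht⟩ := hN.map σ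
  have hle : N.map σ ≤ Finsupp.supported R R (t.biUnion Finsupp.support : Set P) := by
    rw [← ht, Submodule.span_le]
    intro x hx
    rw [SetLike.mem_coe, Finsupp.mem_supported]
    exact_mod_cast Finset.subset_biUnion_of_mem Finsupp.support hx
  have : Module.Finite R N := Module.Finite.iff_fg.mpr hN
  refine hR.exists_isGVIdeal_le_finiteRankIdeal_of_forall_eq_zero (t.biUnion Finsupp.support)
    (fun i ↦ Finsupp.lapply i ∘ₗ σ ∘ₗ N.subtype) fun z hz ↦ ?_
  have hσz : σ z = 0 := Finsupp.ext fun i ↦ by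
    by_cases hi : i ∈ t.biUnion Finsupp.support
    · exact hz i hi
    · exact (Finsupp.mem_supported' R _).mp (hle ⟨z, z.2, rfl⟩) i (by simpa using hi)
  have hz0 : Finsupp.linearCombination R id (σ z) = (z : P) := LinearMap.congr_fun hσ (z : P)
  rw [hσz, map_zero] at hz0
  exact Subtype.ext hz0.symm

theorem IsPvMD.exists_isGVIdeal_smul_mem_range [IsDomain R]
    {K : Type*} [Field K] [Algebra R K] [IsFractionRing R K] (hR : IsPvMD R K)
    {M P₀ P₁ P₂ P₃ : Type*} [AddCommGroup M] [Module R M] [AddCommGroup P₀] [Module R P₀]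
    [AddCommGroup P₁] [Module R P₁] [AddCommGroup P₂] [Module R P₂] [AddCommGroup P₃] [Module R P₃]
    [Module.Projective R P₀] [Module.Flat R P₁]
    {d₁ : P₁ →ₗ[R] P₀} {d₂ : P₂ →ₗ[R] P₁} {d₃ : P₃ →ₗ[R] P₂}
    (h₂ : Function.Exact d₂ d₁) (h₃ : Function.Exact d₃ d₂)
    (c : M ⊗[R] P₂) (hc : d₂.lTensor M c = 0) :
    ∃ J : Ideal R, IsGVIdeal J ∧ ∀ r ∈ J, r • c ∈ LinearMap.range (d₃.lTensor M) := by
  obtain ⟨n, m, p, rfl⟩ := TensorProduct.exists_sum_tmul_eq c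
  rw [map_sum] at hc
  simp only [LinearMap.lTensor_tmul] at hc
  obtain ⟨κ, a, q, hq, ha⟩ :=
    TensorProduct.vanishesTrivially_of_sum_tmul_eq_zero_of_rTensor_injective R
      (Module.Flat.rTensor_preserves_injective_linearMap _ (Submodule.injective_subtype _)) hc
  let N : Submodule R P₀ := Submodule.span R (Set.range fun k ↦ d₁ (q k))
  obtain ⟨J, hJ, hJ'⟩ := hR.exists_isGVIdeal_le_finiteRankIdeal N
    (Submodule.fg_span (Set.finite_range _))
  refine ⟨J, hJ, fun r hr ↦ ?_⟩
  have hN : LinearMap.range N.subtype ≤ LinearMap.range d₁ := by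
    rw [Submodule.range_subtype, Submodule.span_le]
    rintro _ ⟨k, rfl⟩
    exact ⟨q k, rfl⟩
  obtain ⟨h, hh⟩ := exists_comp_eq_of_mem_range_dualTensorHom d₁ N.subtype hN (hJ' hr)
  let z : Fin κ → N := fun k ↦ ⟨d₁ (q k), Submodule.subset_span ⟨k, rfl⟩⟩
  have hz : ∀ i, ∑ k, a i k • z k = 0 := fun i ↦ Subtype.ext <| by
    have := h₂.apply_apply_eq_zero (p i)
    rw [show d₂ (p i) = _ from hq i, map_sum] at this
    simpa [z] using this
  have hv : ∀ k, ∃ v, d₂ v = r • q k - h (z k) := fun k ↦ (h₂ _).mp <| by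
    have := LinearMap.congr_fun hh (z k)
    simp only [LinearMap.comp_apply] at this
    rw [map_sub, this]
    simp [z]
  choose v hv using hv
  have hw : ∀ i, ∃ w, d₃ w = r • p i - ∑ k, a i k • v k := fun i ↦ (h₃ _).mp <| by
    have : h (∑ k, a i k • z k) = 0 := by rw [hz, map_zero]
    rw [map_sum] at this
    simp only [map_smul] at this
    simp [hv, hq, smul_sub, Finset.smul_sum, this, smul_comm r]
  choose w hw using hw
  refine ⟨∑ i, m i ⊗ₜ w i, ?_⟩
  have hsum : ∑ i, m i ⊗ₜ[R] (∑ k, a i k • v k) = 0 :=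
    TensorProduct.sum_tmul_eq_zero_of_vanishesTrivially R ⟨κ, a, v, fun _ ↦ rfl, ha⟩
  simp [hw, TensorProduct.tmul_sub, hsum, Finset.smul_sum]

end FiniteRank

section Converse

variable {R : Type*} [CommRing R]

theorem Function.Exact.exists_projective_lift {P A B C : Type*} [AddCommGroup P] [Module R P]
    [Module.Projective R P] [AddCommGroup A] [Module R A] [AddCommGroup B] [Module R B]
    [AddCommGroup C] [Module R C] {a : A →ₗ[R] B} {b : B →ₗ[R] C} (hab : Function.Exact a b)
    (f : P →ₗ[R] B) (hf : b ∘ₗ f = 0) : ∃ g : P →ₗ[R] A, a ∘ₗ g = f := by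
  obtain ⟨g, hg⟩ := Module.projective_lifting_property a.rangeRestrict
    (f.codRestrict (LinearMap.range a) fun p ↦ (hab _).mp (LinearMap.congr_fun hf p))
    a.surjective_rangeRestrict
  exact ⟨g, LinearMap.ext fun p ↦ congrArg Subtype.val (LinearMap.congr_fun hg p)⟩

theorem one_tmul_eq_zero_iff_mem_smul_top (I : Ideal R) {P : Type*} [AddCommGroup P] [Module R P]
    (p : P) : (1 : R ⧸ I) ⊗ₜ[R] p = 0 ↔ p ∈ I • (⊤ : Submodule R P) := by
  rw [← (TensorProduct.quotTensorEquivQuotSMul P I).map_eq_zero_iff, ← Submodule.Quotient.mk_eq_zero]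
  have := TensorProduct.quotTensorEquivQuotSMul_mk_tmul (M := P) I 1 p
  rw [map_one, one_smul] at this
  rw [this]

theorem Submodule.map_mem_smul_of_mem_smul {A B : Type*} [AddCommGroup A] [Module R A]
    [AddCommGroup B] [Module R B] {I : Ideal R} (f : A →ₗ[R] B) {S : Submodule R A}
    {T : Submodule R B} (hST : S.map f ≤ T) {y : A} (hy : y ∈ I • S) : f y ∈ I • T := by
  have := Submodule.mem_map_of_mem (f := f) hy
  rw [Submodule.map_smul''] at this
  exact Submodule.smul_mono le_rfl hST this

/-- A cycle in `(R ⧸ I) ⊗ P₂` attached to an element `x` of `I F₁` in the kernel of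
`δ : F₁ → F₀`, where `F₁ → F₀ → Q` and `P₃ → P₂ → P₁ → P₀ → Q` are exact. -/
theorem exists_cycle_of_mem_ker {F₀ F₁ P₀ P₁ P₂ P₃ Q : Type*}
    [AddCommGroup F₀] [Module R F₀] [AddCommGroup F₁] [Module R F₁]
    [AddCommGroup P₀] [Module R P₀] [AddCommGroup P₁] [Module R P₁]
    [AddCommGroup P₂] [Module R P₂] [AddCommGroup P₃] [Module R P₃]
    [AddCommGroup Q] [Module R Q]
    [Module.Projective R F₀] [Module.Projective R F₁]
    [Module.Projective R P₀] [Module.Projective R P₁]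
    {δ : F₁ →ₗ[R] F₀} {ρ : F₀ →ₗ[R] Q} (hδ : Function.Exact δ ρ) (hρ : Function.Surjective ρ)
    {d₁ : P₁ →ₗ[R] P₀} {d₂ : P₂ →ₗ[R] P₁} {d₃ : P₃ →ₗ[R] P₂} {π : P₀ →ₗ[R] Q}
    (hπ : Function.Surjective π) (h₁ : Function.Exact d₁ π) (h₂ : Function.Exact d₂ d₁)
    (h₃ : Function.Exact d₃ d₂) (I : Ideal R) {x : F₁} (hx : δ x = 0)
    (hxI : x ∈ I • (⊤ : Submodule R F₁)) :
    ∃ c : (R ⧸ I) ⊗[R] P₂, d₂.lTensor (R ⧸ I) c = 0 ∧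
      ∀ r : R, r • c ∈ LinearMap.range (d₃.lTensor (R ⧸ I)) → r • x ∈ I • LinearMap.ker δ := by
  obtain ⟨f₀, hf₀⟩ := Module.projective_lifting_property π ρ hπ
  obtain ⟨g₀, hg₀⟩ := Module.projective_lifting_property ρ π hρ
  obtain ⟨f₁, hf₁⟩ := h₁.exists_projective_lift (f₀ ∘ₗ δ) <| by
    rw [← LinearMap.comp_assoc, hf₀, hδ.linearMap_comp_eq_zero]
  obtain ⟨g₁, hg₁⟩ := hδ.exists_projective_lift (g₀ ∘ₗ d₁) <| by
    rw [← LinearMap.comp_assoc, hg₀, h₁.linearMap_comp_eq_zero]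
  obtain ⟨s, hs⟩ := hδ.exists_projective_lift (g₀ ∘ₗ f₀ - LinearMap.id) <| by
    rw [LinearMap.comp_sub, ← LinearMap.comp_assoc, hg₀, hf₀, LinearMap.comp_id, sub_self]
  have hf₁' (y) : d₁ (f₁ y) = f₀ (δ y) := LinearMap.congr_fun hf₁ y
  have hg₁' (y) : δ (g₁ y) = g₀ (d₁ y) := LinearMap.congr_fun hg₁ y
  have hs' (y) : δ (s y) = g₀ (f₀ y) - y := LinearMap.congr_fun hs y
  obtain ⟨p, hp⟩ := (h₂ (f₁ x)).mp (by rw [hf₁', hx, map_zero])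
  refine ⟨1 ⊗ₜ p, ?_, fun r ⟨w, hw⟩ ↦ ?_⟩
  · rw [LinearMap.lTensor_tmul, hp, one_tmul_eq_zero_iff_mem_smul_top]
    exact Submodule.map_mem_smul_of_mem_smul f₁ le_top hxI
  · obtain ⟨w, rfl⟩ : ∃ w' : P₃, (1 : R ⧸ I) ⊗ₜ[R] w' = w := 
      TensorProduct.mk_surjective R P₃ (R ⧸ I) Ideal.Quotient.mk_surjective w
    have hw' : r • p - d₃ w ∈ I • (⊤ : Submodule R P₂) := by
      rw [← one_tmul_eq_zero_iff_mem_smul_top, TensorProduct.tmul_sub, TensorProduct.tmul_smul,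
        ← hw, LinearMap.lTensor_tmul, sub_self]
    have h₄ : r • f₁ x ∈ I • LinearMap.ker d₁ := by
      have := Submodule.map_mem_smul_of_mem_smul d₂ (T := LinearMap.ker d₁)
        (by rintro _ ⟨y, -, rfl⟩; exact h₂.apply_apply_eq_zero y) hw'
      rwa [map_sub, map_smul, hp, h₃.apply_apply_eq_zero, sub_zero] at this
    have h₅ : r • g₁ (f₁ x) ∈ I • LinearMap.ker δ := by
      have := Submodule.map_mem_smul_of_mem_smul g₁ (T := LinearMap.ker δ)
        (by rintro _ ⟨y, hy, rfl⟩; simp [hg₁', LinearMap.mem_ker.mp hy]) h₄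
      rwa [map_smul] at this
    have h₆ : g₁ (f₁ x) - x ∈ I • LinearMap.ker δ := by
      have := Submodule.map_mem_smul_of_mem_smul (g₁ ∘ₗ f₁ - LinearMap.id - s ∘ₗ δ) (T := LinearMap.ker δ)
        (by rintro _ ⟨y, -, rfl⟩; simp [hg₁', hf₁', hs']) hxI
      simpa [hx] using this
    have := sub_mem h₅ (Submodule.smul_mem _ r h₆)
    simpa [smul_sub] using this

/-- The linear map `x ↦ a k • x - x k • a`, whose kernel is the intersection of `Rⁿ` with the line
spanned by `a` (if `a k` is a nonzerodivisor). -/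
def proportionalityMap {n : ℕ} (a : Fin n → R) (k : Fin n) : (Fin n → R) →ₗ[R] (Fin n → R) :=
  a k • LinearMap.id - (LinearMap.proj k).smulRight a

theorem proportionalityMap_apply {n : ℕ} (a : Fin n → R) (k : Fin n) (x : Fin n → R) :
    proportionalityMap a k x = a k • x - x k • a :=
  rfl

theorem mem_mul_inv_of_smul_mem_smul_ker [IsDomain R] {K : Type*} [Field K] [Algebra R K]
    [IsFractionRing R K] {n : ℕ} (a : Fin n → R) {k : Fin n}
    (hk : a k ≠ 0) {r : R}
    (hr : r • a ∈ Ideal.span (Set.range a) • LinearMap.ker (proportionalityMap a k)) :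
    algebraMap R K r ∈
      (Ideal.span (Set.range a) : FractionalIdeal (nonZeroDivisors R) K) *
        (Ideal.span (Set.range a) : FractionalIdeal (nonZeroDivisors R) K)⁻¹ := by
  set I := Ideal.span (Set.range a) with hI
  have hak : algebraMap R K (a k) ≠ 0 := by simpa using hk
  have hI0 : I ≠ ⊥ := fun h ↦ hk ((Submodule.eq_bot_iff _).mp h _ (Ideal.subset_span ⟨k, rfl⟩))
  suffices ∀ y ∈ I • LinearMap.ker (proportionalityMap a k),
      algebraMap R K (y k) / algebraMap R K (a k) ∈
        (I : FractionalIdeal (nonZeroDivisors R) K) *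
          (I : FractionalIdeal (nonZeroDivisors R) K)⁻¹ by
    simpa [hak] using this _ hr
  intro y hy
  refine Submodule.smul_induction_on hy (fun i hi l hl ↦ ?_) fun x y hx hy ↦ ?_
  · rw [Pi.smul_apply, smul_eq_mul, map_mul, mul_div_assoc]
    refine FractionalIdeal.mul_mem_mul (FractionalIdeal.mem_coeIdeal_of_mem _ hi) ?_
    rw [FractionalIdeal.mem_inv_iff (FractionalIdeal.coeIdeal_ne_zero.mpr hI0)]
    intro _ hx
    obtain ⟨y, hy, rfl⟩ := (FractionalIdeal.mem_coeIdeal _).mp hx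
    clear hx
    rw [FractionalIdeal.mem_one_iff]
    induction hy using Submodule.span_induction with
    | mem _ hy =>
      obtain ⟨m, rfl⟩ := hy
      have hlm : a k * l m = l k * a m := sub_eq_zero.mp (congrFun (LinearMap.mem_ker.mp hl) m)
      refine ⟨l m, ?_⟩
      rw [div_mul_eq_mul_div, eq_div_iff hak, ← map_mul, ← map_mul, mul_comm, hlm]
    | zero => exact ⟨0, by simp⟩
    | add x y _ _ hx hy =>
      obtain ⟨s, hs⟩ := hx
      obtain ⟨t, ht⟩ := hy
      exact ⟨s + t, by rw [map_add, map_add, mul_add, hs, ht]⟩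
    | smul c x _ hx =>
      obtain ⟨s, hs⟩ := hx
      exact ⟨c * s, by rw [smul_eq_mul, map_mul, map_mul, hs, mul_left_comm]⟩
  · rw [Pi.add_apply, map_add, add_div]
    exact Submodule.add_mem (FractionalIdeal.coeToSubmodule _) hx hy

end Converse

theorem isPvMD_of_isGVTorsionElem_tor {R : Type u} [CommRing R] [IsDomain R]
    {K : Type*} [Field K] [Algebra R K] [IsFractionRing R K]
    (h : ∀ (M N : Type u) [AddCommGroup M] [Module R M] [AddCommGroup N] [Module R N],
      ∀ x : ((Tor (ModuleCat.{u} R) 2).obj (ModuleCat.of R M)).obj (ModuleCat.of R N),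
        IsGVTorsionElem R x) : IsPvMD R K := by
  intro I hI hfg
  obtain ⟨n, a, rfl⟩ := Submodule.fg_iff_exists_fin_generating_family.mp hfg
  obtain ⟨k, hk⟩ : ∃ k, a k ≠ 0 := by
    by_contra! ha
    refine hI (Submodule.span_eq_bot.mpr ?_)
    rintro _ ⟨k, rfl⟩
    exact ha k
  let δ := proportionalityMap a k
  let Q := (Fin n → R) ⧸ LinearMap.range δ
  let P : ProjectiveResolution (ModuleCat.of R Q) := projectiveResolution (ModuleCat.of R Q)
  have hP (i : ℕ) : Module.Projective R (P.complex.X i) :=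
    (IsProjective.iff_projective _).mpr (P.projective i)
  have haI : a ∈ Submodule.span R (Set.range a) • (⊤ : Submodule R (Fin n → R)) := by
    have : ∑ i, a i • (fun j ↦ if i = j then (1 : R) else 0) ∈
        Submodule.span R (Set.range a) • (⊤ : Submodule R (Fin n → R)) :=
      sum_mem fun i _ ↦ Submodule.smul_mem_smul (Submodule.subset_span ⟨i, rfl⟩) trivial
    rwa [← pi_eq_sum_univ a] at this
  obtain ⟨c, hc, hc'⟩ := exists_cycle_of_mem_ker (δ := δ) (ρ := (LinearMap.range δ).mkQ)
    (LinearMap.exact_map_mkQ_range δ) (Submodule.mkQ_surjective _) (π := (P.π.f 0).hom)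
    ((ModuleCat.epi_iff_surjective _).mp inferInstance)
    ((ShortComplex.ShortExact.moduleCat_exact_iff_function_exact _).mp P.exact₀)
    (P.function_exact 0) (P.function_exact 1) (Submodule.span R (Set.range a)) (x := a)
    (by rw [proportionalityMap_apply, sub_self])
    haI
  obtain ⟨J, hJ, hJ'⟩ := (forall_isGVTorsionElem_tor_succ_iff P 1).mp
    (h (R ⧸ Submodule.span R (Set.range a)) Q) c hc
  refine ⟨J, hJ, fun y hy ↦ ?_⟩
  obtain ⟨r, hr, rfl⟩ := (FractionalIdeal.mem_coeIdeal _).mp hy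
  exact mem_mul_inv_of_smul_mem_smul_ker a hk (hc' r (hJ' r hr))

theorem IsPvMD.isGVTorsionElem_tor {R : Type u} [CommRing R] [IsDomain R]
    {K : Type*} [Field K] [Algebra R K] [IsFractionRing R K]
    (hR : IsPvMD R K) (M N : ModuleCat.{u} R)
    (x : ((Tor (ModuleCat.{u} R) 2).obj M).obj N) : IsGVTorsionElem R x := by
  let P := projectiveResolution N
  have hP (i : ℕ) : Module.Projective R (P.complex.X i) :=
    (IsProjective.iff_projective _).mpr (P.projective i)
  exact (forall_isGVTorsionElem_tor_succ_iff P 1).mpr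
    (fun c ↦ hR.exists_isGVIdeal_smul_mem_range (P.function_exact 0) (P.function_exact 1) c) x

/-- `R` is a PvMD iff `Tor₂^R(M, N)` is GV-torsion for all `R`-modules
`M`, `N`. -/
theorem pvmd_iff_tor_two_gvTorsion {R : Type u} [CommRing R] [IsDomain R] :
    IsPvMD R (FractionRing R) ↔
      ∀ (M N : Type u) [AddCommGroup M] [Module R M] [AddCommGroup N] [Module R N],
        ∀ x : ((Tor (ModuleCat.{u} R) 2).obj (ModuleCat.of R M)).obj (ModuleCat.of R N),
          IsGVTorsionElem R x := by
  exact ⟨fun hR M N _ _ _ _ ↦ hR.isGVTorsionElem_tor _ _, isPvMD_of_isGVTorsionElem_tor⟩
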